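/- arXiv:1307.8442 — 2 statements merged into one kernel-verified Lean document; each statement's English description precedes it below -/
import Mathlib

section
/- Let 𝒢 = (φ_j : G → G_j : 1 ≤ j ≤ m) be a finite Abelian group HBL datum (i.e., G and all G_j are finite) and let s ∈ [0,1]^m. If there exists a subgroup H with {0} < H < G (nonzero and proper) satisfying A(H,s) ≥ 1, then 𝔹(𝒢,s) = 𝔸(𝒢,s). -/
open scoped ENNReal

/-- The `L^{1/s}` norm with respect to counting measure; for `s = 0` this is the sup norm
`‖f‖_∞`, and for `s ≠ 0` it is `(∑_y f(y)^{1/s})^s`. -/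
noncomputable def HBLnorm {α : Type*} (s : ℝ) (f : α → ℝ≥0∞) : ℝ≥0∞ :=
  if s = 0 then ⨆ y, f y else (∑' y, f y ^ (1 / s)) ^ s

/-- The optimal constant `𝔹(𝒢,s)`: the smallest `C ∈ [0,∞]` such that
`∑_{x ∈ G} ∏_j f_j(φ_j x) ≤ C ∏_j ‖f_j‖_{1/s_j}` for all nonnegative `f_j`. -/
noncomputable def HBLB {G : Type*} [AddCommGroup G] {m : ℕ} {Gj : Fin m → Type*}
    [∀ j, AddCommGroup (Gj j)] (φ : ∀ j, G →+ Gj j) (s : Fin m → ℝ) : ℝ≥0∞ :=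
  sInf {C : ℝ≥0∞ | ∀ f : ∀ j, Gj j → ℝ≥0∞,
    ∑' x : G, ∏ j, f j (φ j x) ≤ C * ∏ j, HBLnorm (s j) (f j)}

/-- The quantity `A(H,s) = |H| · ∏_j |φ_j(H)|^{-s_j}` associated to a subgroup `H ≤ G`. -/
noncomputable def HBLAloc {G : Type*} [AddCommGroup G] {m : ℕ} {Gj : Fin m → Type*}
    [∀ j, AddCommGroup (Gj j)] (φ : ∀ j, G →+ Gj j) (s : Fin m → ℝ) (H : AddSubgroup G) :
    ℝ≥0∞ :=
  (Nat.card H : ℝ≥0∞) * ∏ j, (Nat.card (H.map (φ j)) : ℝ≥0∞) ^ (-(s j))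

/-- `𝔸(𝒢,s) = sup { A(H,s) : H a finite subgroup of G }`. -/
noncomputable def HBLA {G : Type*} [AddCommGroup G] {m : ℕ} {Gj : Fin m → Type*}
    [∀ j, AddCommGroup (Gj j)] (φ : ∀ j, G →+ Gj j) (s : Fin m → ℝ) : ℝ≥0∞ :=
  ⨆ (H : AddSubgroup G) (_ : (H : Set G).Finite), HBLAloc φ s H

/-- The convolution square of a function on a finite Abelian group. -/
noncomputable def convSq {A : Type*} [AddCommGroup A] [Fintype A] (μ : A → ℝ) (z : A) : ℝ :=
  ∑ y, μ y * μ (z - y)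

section ConvSq

variable {A : Type*} [AddCommGroup A] [Fintype A] {μ : A → ℝ}

lemma convSq_mem_stdSimplex (hμ : μ ∈ stdSimplex ℝ A) : convSq μ ∈ stdSimplex ℝ A := by
  refine ⟨fun z => Finset.sum_nonneg fun y _ => mul_nonneg (hμ.1 _) (hμ.1 _), ?_⟩
  unfold convSq
  rw [Finset.sum_comm]
  have hshift (y : A) : ∑ z, μ y * μ (z - y) = μ y := by
    rw [← Finset.mul_sum]
    exact (congrArg (μ y * ·) ((Equiv.sum_comp (Equiv.subRight y) μ).trans hμ.2)).trans (mul_one _)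
  simp_rw [hshift]
  exact hμ.2

lemma sum_mul_sq_sub_convSq (hμ : μ ∈ stdSimplex ℝ A) :
    ∑ z, ∑ y, μ y * (μ (z - y) - convSq μ z) ^ 2 = ∑ y, μ y ^ 2 - ∑ z, convSq μ z ^ 2 := by
  have hvar (z : A) : ∑ y, μ y * (μ (z - y) - convSq μ z) ^ 2
      = ∑ y, μ y * μ (z - y) ^ 2 - convSq μ z ^ 2 := by
    have expand : ∀ y, μ y * (μ (z - y) - convSq μ z) ^ 2
        = μ y * μ (z - y) ^ 2 - 2 * convSq μ z * (μ y * μ (z - y)) + convSq μ z ^ 2 * μ y :=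
      fun y => by ring
    simp_rw [expand]
    rw [Finset.sum_add_distrib, Finset.sum_sub_distrib, ← Finset.mul_sum, ← Finset.mul_sum, hμ.2]
    change _ - 2 * convSq μ z * convSq μ z + _ = _
    ring
  simp_rw [hvar]
  rw [Finset.sum_sub_distrib, Finset.sum_comm]
  have hshift (y : A) : ∑ z, μ y * μ (z - y) ^ 2 = μ y * ∑ a, μ a ^ 2 := by
    rw [← Finset.mul_sum]
    exact congrArg (μ y * ·) (Equiv.sum_comp (Equiv.subRight y) fun a => μ a ^ 2)
  simp_rw [hshift]
  rw [← Finset.sum_mul, hμ.2, one_mul]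

lemma sum_convSq_sq_le (hμ : μ ∈ stdSimplex ℝ A) : ∑ z, convSq μ z ^ 2 ≤ ∑ y, μ y ^ 2 := by
  rw [← sub_nonneg, ← sum_mul_sq_sub_convSq hμ]
  exact Finset.sum_nonneg fun z _ => Finset.sum_nonneg fun y _ => mul_nonneg (hμ.1 _) (sq_nonneg _)

/-- If convolution does not decrease the `L²` norm of a probability vector, then the vector is
invariant under differences of elements of its support. -/
lemma invariant_of_sum_sq_le_convSq (hμ : μ ∈ stdSimplex ℝ A)
    (h : ∑ y, μ y ^ 2 ≤ ∑ z, convSq μ z ^ 2) {y y' : A} (hy : μ y ≠ 0) (hy' : μ y' ≠ 0) (a : A) :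
    μ (a + (y - y')) = μ a := by
  have hterm (z y : A) : 0 ≤ μ y * (μ (z - y) - convSq μ z) ^ 2 :=
    mul_nonneg (hμ.1 _) (sq_nonneg _)
  have hzero : ∑ z, ∑ y, μ y * (μ (z - y) - convSq μ z) ^ 2 = 0 :=
    le_antisymm (by rw [sum_mul_sq_sub_convSq hμ]; linarith)
      (Finset.sum_nonneg fun z _ => Finset.sum_nonneg fun y _ => hterm z y)
  have hconst {y : A} (hy : μ y ≠ 0) (z : A) : μ (z - y) = convSq μ z := by
    have h1 := (Finset.sum_eq_zero_iff_of_nonneg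
      fun z _ => Finset.sum_nonneg fun y _ => hterm z y).1 hzero z (Finset.mem_univ z)
    have h2 := (Finset.sum_eq_zero_iff_of_nonneg fun y _ => hterm z y).1 h1 y (Finset.mem_univ y)
    exact sub_eq_zero.1 (pow_eq_zero_iff two_ne_zero |>.1 ((mul_eq_zero.1 h2).resolve_left hy))
  have e1 := hconst hy (a + y)
  have e2 := hconst hy' (a + y)
  rw [add_sub_cancel_right] at e1
  rw [← add_sub_assoc, e1, e2]

end ConvSq

lemma HBLnorm_of_ne_zero {α : Type*} [Fintype α] {r : ℝ} (hr : r ≠ 0) (f : α → ℝ≥0∞) :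
    HBLnorm r f = (∑ y, f y ^ (1 / r)) ^ r := by
  rw [HBLnorm, if_neg hr, tsum_fintype]

lemma le_HBLnorm {α : Type*} [Fintype α] {r : ℝ} (hr : 0 ≤ r) (f : α → ℝ≥0∞) (y : α) :
    f y ≤ HBLnorm r f := by
  by_cases h0 : r = 0
  · rw [HBLnorm, if_pos h0]
    exact le_iSup f y
  · rw [HBLnorm_of_ne_zero h0]
    calc f y = (f y ^ (1 / r)) ^ r := by
          rw [← ENNReal.rpow_mul, one_div_mul_cancel h0, ENNReal.rpow_one]
      _ ≤ _ := ENNReal.rpow_le_rpow (Finset.single_le_sum (f := fun y => f y ^ (1 / r))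
          (fun _ _ => zero_le) (Finset.mem_univ y)) hr

lemma HBLnorm_indicator_one {α : Type*} [Fintype α] {r : ℝ} (hr₀ : 0 ≤ r) {S : Set α}
    (hS : S.Nonempty) :
    HBLnorm r (S.indicator fun _ => 1) = (Nat.card S : ℝ≥0∞) ^ r := by
  classical
  by_cases hr : r = 0
  · rw [HBLnorm, if_pos hr, hr, ENNReal.rpow_zero]
    obtain ⟨y, hy⟩ := hS
    refine le_antisymm (iSup_le fun z => Set.indicator_le_self' (by simp) z)
      (le_iSup_of_le y (by simp [hy]))
  · rw [HBLnorm_of_ne_zero hr]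
    congr 1
    have hpow (y : α) : S.indicator (fun _ => (1 : ℝ≥0∞)) y ^ (1 / r) = if y ∈ S then 1 else 0 := by
      by_cases hy : y ∈ S
      · simp [hy]
      · simp [hy, ENNReal.zero_rpow_of_pos, hr₀.lt_of_ne' hr]
    simp_rw [hpow]
    simp [Nat.card_eq_fintype_card, Fintype.card_subtype]

lemma ofReal_card_mul_prod_eq_HBLAloc {G : Type*} [AddCommGroup G] {m : ℕ} {Gj : Fin m → Type*}
    [∀ j, AddCommGroup (Gj j)] [∀ j, Finite (Gj j)] (φ : ∀ j, G →+ Gj j) (s : Fin m → ℝ)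
    (H : AddSubgroup G) :
    ENNReal.ofReal (Nat.card H * ∏ j, (Nat.card (H.map (φ j)) : ℝ) ^ (-(s j)))
      = HBLAloc φ s H := by
  rw [HBLAloc, ENNReal.ofReal_mul (Nat.cast_nonneg _), ENNReal.ofReal_natCast,
    ENNReal.ofReal_prod_of_nonneg fun j _ => Real.rpow_nonneg (Nat.cast_nonneg _) _]
  congr 1
  refine Finset.prod_congr rfl fun j _ => ?_
  rw [← ENNReal.ofReal_rpow_of_pos (by exact_mod_cast Nat.card_pos), ENNReal.ofReal_natCast]

section Functional

variable {G : Type*} [AddCommGroup G] [Fintype G] {m : ℕ} {Gj : Fin m → Type*}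
  [∀ j, AddCommGroup (Gj j)]

/-- The multilinear form evaluated at the powers `μ_j ^ s_j`. -/
noncomputable def powerForm (φ : ∀ j, G →+ Gj j) (s : Fin m → ℝ) (μ : ∀ j, Gj j → ℝ) : ℝ :=
  ∑ x, ∏ j, μ j (φ j x) ^ s j

variable {φ : ∀ j, G →+ Gj j} {s : Fin m → ℝ}

lemma continuous_powerForm (hs : ∀ j, 0 ≤ s j) : Continuous (powerForm φ s) := by
  unfold powerForm
  refine continuous_finsetSum _ fun x _ => continuous_finsetProd _ fun j _ => ?_
  exact (Real.continuous_rpow_const (hs j)).comp (by fun_prop)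

variable [∀ j, Fintype (Gj j)]

/-- A bound on the product of simplices extends to all nonnegative vectors by homogeneity. -/
lemma powerForm_le_mul_prod {M : ℝ}
    (hM : ∀ ν : ∀ j, Gj j → ℝ, (∀ j, ν j ∈ stdSimplex ℝ (Gj j)) → powerForm φ s ν ≤ M)
    {μ : ∀ j, Gj j → ℝ} (hμ : ∀ j y, 0 ≤ μ j y) :
    powerForm φ s μ ≤ M * ∏ j, (∑ y, μ j y) ^ s j := by
  classical
  have hnormalize (j : Fin m) : ∃ ν ∈ stdSimplex ℝ (Gj j),
      ∀ y, μ j y ^ s j ≤ ν y ^ s j * (∑ y, μ j y) ^ s j := by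
    have hS : 0 ≤ ∑ y, μ j y := Finset.sum_nonneg fun y _ => hμ j y
    by_cases h0 : ∑ y, μ j y = 0
    · refine ⟨Pi.single 0 1, single_mem_stdSimplex ℝ _, fun y => ?_⟩
      have hy : μ j y = 0 :=
        (Finset.sum_eq_zero_iff_of_nonneg fun y _ => hμ j y).1 h0 y (Finset.mem_univ y)
      rw [h0, hy]
      by_cases hsj : s j = 0
      · simp [hsj]
      · simp [Real.zero_rpow hsj]
    · refine ⟨fun y => μ j y / ∑ y, μ j y, ⟨fun y => div_nonneg (hμ j y) hS, ?_⟩, fun y => ?_⟩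
      · rw [← Finset.sum_div, div_self h0]
      · rw [← Real.mul_rpow (div_nonneg (hμ j y) hS) hS, div_mul_cancel₀ _ h0]
  choose ν hν hle using hnormalize
  calc powerForm φ s μ
      ≤ ∑ x, ∏ j, (ν j (φ j x) ^ s j * (∑ y, μ j y) ^ s j) :=
        Finset.sum_le_sum fun x _ => Finset.prod_le_prod
          (fun j _ => Real.rpow_nonneg (hμ j _) _) fun j _ => hle j _
    _ = powerForm φ s ν * ∏ j, (∑ y, μ j y) ^ s j := by
        simp_rw [Finset.prod_mul_distrib, ← Finset.sum_mul]; rfl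
    _ ≤ M * ∏ j, (∑ y, μ j y) ^ s j :=
        mul_le_mul_of_nonneg_right (hM ν hν) (Finset.prod_nonneg fun j _ =>
          Real.rpow_nonneg (Finset.sum_nonneg fun y _ => hμ j y) _)

lemma powerForm_sq_le_mul_powerForm_convSq {M : ℝ}
    (hM : ∀ ν : ∀ j, Gj j → ℝ, (∀ j, ν j ∈ stdSimplex ℝ (Gj j)) → powerForm φ s ν ≤ M)
    {μ : ∀ j, Gj j → ℝ} (hμ : ∀ j y, 0 ≤ μ j y) :
    powerForm φ s μ ^ 2 ≤ M * powerForm φ s fun j => convSq (μ j) := by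
  have hsplit : powerForm φ s μ ^ 2
      = ∑ z, powerForm φ s fun j u => μ j u * μ j (φ j z - u) := by
    unfold powerForm
    rw [sq, Finset.sum_mul_sum]
    conv_rhs => rw [Finset.sum_comm]
    refine Finset.sum_congr rfl fun x _ => ?_
    rw [← Equiv.sum_comp (Equiv.subRight x)]
    refine Finset.sum_congr rfl fun z _ => ?_
    rw [← Finset.prod_mul_distrib]
    refine Finset.prod_congr rfl fun j _ => ?_
    rw [Real.mul_rpow (hμ _ _) (hμ _ _), Equiv.subRight_apply, map_sub]
  rw [hsplit]
  conv_rhs => unfold powerForm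
  rw [Finset.mul_sum]
  exact Finset.sum_le_sum fun z _ =>
    powerForm_le_mul_prod hM fun j y => mul_nonneg (hμ _ _) (hμ _ _)

lemma powerForm_convSq_of_maximal {M : ℝ}
    (hM : ∀ ν : ∀ j, Gj j → ℝ, (∀ j, ν j ∈ stdSimplex ℝ (Gj j)) → powerForm φ s ν ≤ M)
    {μ : ∀ j, Gj j → ℝ} (hμ : ∀ j, μ j ∈ stdSimplex ℝ (Gj j)) (hμM : powerForm φ s μ = M)
    (hMpos : 0 < M) : powerForm φ s (fun j => convSq (μ j)) = M := by
  refine le_antisymm (hM _ fun j => convSq_mem_stdSimplex (hμ j)) ?_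
  have := powerForm_sq_le_mul_powerForm_convSq hM fun j => (hμ j).1
  rw [hμM, sq] at this
  exact le_of_mul_le_mul_left this hMpos

/-- The power form has a maximizer on the product of simplices all of whose components are
invariant under differences of elements of their supports. -/
lemma exists_invariant_maximizer (φ : ∀ j, G →+ Gj j) (hs : ∀ j, 0 ≤ s j) :
    ∃ μ : ∀ j, Gj j → ℝ, (∀ j, μ j ∈ stdSimplex ℝ (Gj j)) ∧ 1 ≤ powerForm φ s μ ∧
      (∀ ν : ∀ j, Gj j → ℝ, (∀ j, ν j ∈ stdSimplex ℝ (Gj j)) →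
        powerForm φ s ν ≤ powerForm φ s μ) ∧
      ∀ j y y', μ j y ≠ 0 → μ j y' ≠ 0 → ∀ a, μ j (a + (y - y')) = μ j a := by
  classical
  let S : Set (∀ j, Gj j → ℝ) := Set.univ.pi fun j => stdSimplex ℝ (Gj j)
  have hS : IsCompact S := isCompact_univ_pi fun j => isCompact_stdSimplex ℝ (Gj j)
  let δ : ∀ j, Gj j → ℝ := fun j => Pi.single 0 1
  have hδ : δ ∈ S := fun j _ => single_mem_stdSimplex ℝ _
  obtain ⟨ν, hνS, hν⟩ := hS.exists_isMaxOn ⟨δ, hδ⟩ (continuous_powerForm (φ := φ) hs).continuousOn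
  have hbound : ∀ ρ : ∀ j, Gj j → ℝ, (∀ j, ρ j ∈ stdSimplex ℝ (Gj j)) →
      powerForm φ s ρ ≤ powerForm φ s ν := fun ρ hρ => hν fun j _ => hρ j
  have hδ1 : 1 ≤ powerForm φ s δ := by
    have hle := Finset.single_le_sum
      (f := fun x => ∏ j, δ j (φ j x) ^ s j) (fun x _ => Finset.prod_nonneg fun j _ =>
        Real.rpow_nonneg ((hδ j trivial).1 _) _) (Finset.mem_univ (0 : G))
    simpa [δ, powerForm] using hle
  have hν1 : 1 ≤ powerForm φ s ν := hδ1.trans (hν hδ)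
  have hT : IsCompact (S ∩ {ρ | powerForm φ s ρ = powerForm φ s ν}) :=
    hS.inter_right (isClosed_eq (continuous_powerForm hs) continuous_const)
  obtain ⟨μ, ⟨hμS, hμν⟩, hμ⟩ := hT.exists_isMinOn ⟨ν, hνS, rfl⟩
    (f := fun ρ => ∑ j, ∑ y, ρ j y ^ 2) (by fun_prop)
  rw [Set.mem_ofPred_eq] at hμν
  have hμS' : ∀ j, μ j ∈ stdSimplex ℝ (Gj j) := fun j => hμS j trivial
  refine ⟨μ, hμS', hμν ▸ hν1, fun ρ hρ => hμν ▸ hbound ρ hρ, fun j y y' hy hy' a => ?_⟩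
  have hmin : ∑ j, ∑ y, μ j y ^ 2 ≤ ∑ j, ∑ y, convSq (μ j) y ^ 2 :=
    hμ (a := fun j => convSq (μ j)) ⟨fun j _ => convSq_mem_stdSimplex (hμS' j),
      powerForm_convSq_of_maximal hbound hμS' hμν (zero_lt_one.trans_le hν1)⟩
  have heq := (Finset.sum_eq_sum_iff_of_le fun j _ => sum_convSq_sq_le (hμS' j)).1
    (le_antisymm (Finset.sum_le_sum fun j _ => sum_convSq_sq_le (hμS' j)) hmin)
  exact invariant_of_sum_sq_le_convSq (hμS' j) (heq j (Finset.mem_univ j)).ge hy hy' a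

/-- For vectors invariant under differences of elements of their supports, the power form is
bounded by the quantity `A(H,s)` of the subgroup `H` of common periods. -/
lemma exists_powerForm_le_of_invariant {μ : ∀ j, Gj j → ℝ}
    (hs : ∀ j, 0 ≤ s j) (hμ : ∀ j, μ j ∈ stdSimplex ℝ (Gj j))
    (hinv : ∀ j y y', μ j y ≠ 0 → μ j y' ≠ 0 → ∀ a, μ j (a + (y - y')) = μ j a) :
    ∃ H : AddSubgroup G,
      powerForm φ s μ ≤ Nat.card H * ∏ j, (Nat.card (H.map (φ j)) : ℝ) ^ (-(s j)) := by
  classical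
  let H : AddSubgroup G :=
    { carrier := {h | ∀ j, s j ≠ 0 → ∀ a, μ j (a + φ j h) = μ j a}
      zero_mem' := by simp
      add_mem' := fun {x y} hx hy j hj a => by
        rw [map_add, ← add_assoc, hy j hj, hx j hj]
      neg_mem' := fun {x} hx j hj a => by
        rw [← hx j hj (a + φ j (-x)), add_assoc, ← map_add, neg_add_cancel, map_zero, add_zero] }
  refine ⟨H, ?_⟩
  let T : Finset G := Finset.univ.filter fun x => ∀ j, s j ≠ 0 → μ j (φ j x) ≠ 0
  have hcard : T.card ≤ Nat.card H := by
    rcases T.eq_empty_or_nonempty with hT | ⟨x₀, hx₀⟩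
    · simp [hT]
    · have hmaps : ∀ x ∈ T, x - x₀ ∈ H := fun x hx j hj a => by
        rw [map_sub]
        exact hinv j _ _ ((Finset.mem_filter.1 hx).2 j hj) ((Finset.mem_filter.1 hx₀).2 j hj) a
      rw [← Nat.card_eq_finsetCard T]
      exact Nat.card_le_card_of_injective (fun x : T => (⟨x - x₀, hmaps x x.2⟩ : H))
        fun x y hxy => Subtype.ext (sub_left_injective (congrArg Subtype.val hxy))
  have hpoint (j : Fin m) (hj : s j ≠ 0) (y : Gj j) :
      μ j y ≤ (Nat.card (H.map (φ j)) : ℝ)⁻¹ := by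
    have hpos : (0 : ℝ) < Nat.card (H.map (φ j)) := by exact_mod_cast Nat.card_pos
    rw [← one_div, le_div_iff₀ hpos]
    have hperiod (k : H.map (φ j)) : μ j (y + k) = μ j y := by
      obtain ⟨h, hh, hk⟩ := k.2
      rw [← hk]
      exact hh j hj y
    calc μ j y * Nat.card (H.map (φ j)) = ∑ k : H.map (φ j), μ j (y + k) := by
          simp [hperiod, mul_comm]
      _ = ∑ a ∈ Finset.univ.image fun k : H.map (φ j) => y + k, μ j a :=
          (Finset.sum_image fun k _ l _ hkl => Subtype.ext (add_left_cancel hkl)).symm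
      _ ≤ ∑ a, μ j a :=
          Finset.sum_le_sum_of_subset_of_nonneg (Finset.subset_univ _) fun a _ _ => (hμ j).1 a
      _ = 1 := (hμ j).2
  have hterm (x : G) : ∏ j, μ j (φ j x) ^ s j ≤
      if x ∈ T then ∏ j, (Nat.card (H.map (φ j)) : ℝ) ^ (-(s j)) else 0 := by
    split_ifs with hx
    · refine Finset.prod_le_prod (fun j _ => Real.rpow_nonneg ((hμ j).1 _) _) fun j _ => ?_
      by_cases hj : s j = 0
      · simp [hj]
      · rw [Real.rpow_neg (Nat.cast_nonneg _), ← Real.inv_rpow (Nat.cast_nonneg _)]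
        exact Real.rpow_le_rpow ((hμ j).1 _) (hpoint j hj _) (hs j)
    · obtain ⟨j, hj, h0⟩ : ∃ j, s j ≠ 0 ∧ μ j (φ j x) = 0 := by
        simpa [T] using hx
      exact (Finset.prod_eq_zero (Finset.mem_univ j) (by rw [h0, Real.zero_rpow hj])).le
  calc powerForm φ s μ
      ≤ ∑ x, if x ∈ T then ∏ j, (Nat.card (H.map (φ j)) : ℝ) ^ (-(s j)) else 0 :=
        Finset.sum_le_sum fun x _ => hterm x
    _ = T.card * ∏ j, (Nat.card (H.map (φ j)) : ℝ) ^ (-(s j)) := by simp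
    _ ≤ _ := by gcongr

lemma sum_prod_le_of_powerForm_le {M : ℝ} (hs : ∀ j, 0 ≤ s j) (hMpos : 0 < M)
    (hM : ∀ ν : ∀ j, Gj j → ℝ, (∀ j, ν j ∈ stdSimplex ℝ (Gj j)) → powerForm φ s ν ≤ M)
    (f : ∀ j, Gj j → ℝ≥0∞) :
    ∑ x, ∏ j, f j (φ j x) ≤ ENNReal.ofReal M * ∏ j, HBLnorm (s j) (f j) := by
  by_cases hzero : ∃ j, HBLnorm (s j) (f j) = 0
  · obtain ⟨j, hj⟩ := hzero
    have hLHS : ∑ x, ∏ j, f j (φ j x) = 0 := Finset.sum_eq_zero fun x _ =>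
      Finset.prod_eq_zero (Finset.mem_univ j) (le_zero_iff.1 (hj ▸ le_HBLnorm (hs j) (f j) _))
    rw [hLHS]
    exact zero_le
  push Not at hzero
  by_cases htop : ∃ j, HBLnorm (s j) (f j) = ∞
  · obtain ⟨j, hj⟩ := htop
    have hprod : ∏ j, HBLnorm (s j) (f j) = ∞ := by
      rw [← Finset.mul_prod_erase _ _ (Finset.mem_univ j), hj]
      exact ENNReal.top_mul (Finset.prod_ne_zero_iff.2 fun i _ => hzero i)
    rw [hprod, ENNReal.mul_top (by simpa using hMpos)]
    exact le_top
  push Not at htop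
  have hfin (j : Fin m) (y : Gj j) : f j y ≠ ∞ :=
    ne_top_of_le_ne_top (htop j) (le_HBLnorm (hs j) (f j) y)
  let μ : ∀ j, Gj j → ℝ := fun j y => (f j y ^ (1 / s j)).toReal
  have hμ : ∀ j y, 0 ≤ μ j y := fun j y => ENNReal.toReal_nonneg
  have hμf (j : Fin m) (y : Gj j) : ENNReal.ofReal (μ j y) = f j y ^ (1 / s j) :=
    ENNReal.ofReal_toReal (ENNReal.rpow_ne_top_of_nonneg (one_div_nonneg.2 (hs j)) (hfin j y))
  let N : Fin m → ℝ≥0∞ := fun j => if s j = 0 then HBLnorm (s j) (f j) else 1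
  have hfN (j : Fin m) (y : Gj j) : f j y ≤ N j * ENNReal.ofReal (μ j y ^ s j) := by
    by_cases hj : s j = 0
    · simpa [N, hj] using le_HBLnorm le_rfl (f j) y
    · rw [← ENNReal.ofReal_rpow_of_nonneg (hμ j y) (hs j), hμf, ← ENNReal.rpow_mul,
        one_div_mul_cancel hj]
      simp [N, hj]
  have hnorm (j : Fin m) :
      N j * ENNReal.ofReal ((∑ y, μ j y) ^ s j) = HBLnorm (s j) (f j) := by
    by_cases hj : s j = 0
    · simp [N, hj]
    · rw [← ENNReal.ofReal_rpow_of_nonneg (Finset.sum_nonneg fun y _ => hμ j y) (hs j),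
        ENNReal.ofReal_sum_of_nonneg fun y _ => hμ j y, HBLnorm_of_ne_zero hj]
      simp [N, hj, hμf]
  calc ∑ x, ∏ j, f j (φ j x)
      ≤ ∑ x, ∏ j, (N j * ENNReal.ofReal (μ j (φ j x) ^ s j)) :=
        Finset.sum_le_sum fun x _ => Finset.prod_le_prod' fun j _ => hfN j _
    _ = (∏ j, N j) * ENNReal.ofReal (powerForm φ s μ) := by
        simp_rw [Finset.prod_mul_distrib, ← Finset.mul_sum]
        rw [powerForm, ENNReal.ofReal_sum_of_nonneg fun x _ =>
          Finset.prod_nonneg fun j _ => Real.rpow_nonneg (hμ _ _) _]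
        congr 1
        exact Finset.sum_congr rfl fun x _ =>
          (ENNReal.ofReal_prod_of_nonneg fun j _ => Real.rpow_nonneg (hμ _ _) _).symm
    _ ≤ (∏ j, N j) * ENNReal.ofReal (M * ∏ j, (∑ y, μ j y) ^ s j) := by
        gcongr
        exact powerForm_le_mul_prod hM hμ
    _ = ENNReal.ofReal M * ∏ j, HBLnorm (s j) (f j) := by
        rw [ENNReal.ofReal_mul hMpos.le, ENNReal.ofReal_prod_of_nonneg fun j _ =>
          Real.rpow_nonneg (Finset.sum_nonneg fun y _ => hμ j y) _, mul_left_comm,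
          ← Finset.prod_mul_distrib]
        simp_rw [hnorm]

lemma HBLB_le_HBLA (φ : ∀ j, G →+ Gj j) (hs : ∀ j, 0 ≤ s j) : HBLB φ s ≤ HBLA φ s := by
  obtain ⟨μ, hμ, hμ1, hmax, hinv⟩ := exists_invariant_maximizer φ hs
  obtain ⟨H, hH⟩ := exists_powerForm_le_of_invariant (φ := φ) hs hμ hinv
  calc HBLB φ s ≤ ENNReal.ofReal (powerForm φ s μ) := sInf_le fun f => by
        rw [tsum_fintype]
        exact sum_prod_le_of_powerForm_le hs (zero_lt_one.trans_le hμ1) hmax f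
    _ ≤ HBLAloc φ s H := by
        rw [← ofReal_card_mul_prod_eq_HBLAloc]
        exact ENNReal.ofReal_le_ofReal hH
    _ ≤ HBLA φ s := le_iSup₂ (f := fun (H : AddSubgroup G) (_ : (H : Set G).Finite) =>
        HBLAloc φ s H) H (Set.toFinite _)

lemma HBLA_le_HBLB (φ : ∀ j, G →+ Gj j) (hs : ∀ j, 0 ≤ s j) : HBLA φ s ≤ HBLB φ s := by
  classical
  refine iSup₂_le fun H _ => le_sInf fun C hC => ?_
  have htest := hC fun j => (H.map (φ j) : Set (Gj j)).indicator fun _ => 1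
  rw [tsum_fintype] at htest
  simp_rw [fun j => HBLnorm_indicator_one (hs j) (ZeroMemClass.coe_nonempty (H.map (φ j)))] at htest
  have hcard : (Nat.card H : ℝ≥0∞)
      ≤ ∑ x, ∏ j, (H.map (φ j) : Set (Gj j)).indicator (fun _ => (1 : ℝ≥0∞)) (φ j x) := by
    calc (Nat.card H : ℝ≥0∞) = ∑ x : G, if x ∈ H then 1 else 0 := by
          simp [Nat.card_eq_fintype_card, Fintype.card_subtype]
      _ ≤ _ := Finset.sum_le_sum fun x _ => by
          split_ifs with hx
          · exact (Finset.prod_eq_one fun j _ =>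
              Set.indicator_of_mem (AddSubgroup.mem_map_of_mem (φ j) hx) _).ge
          · exact zero_le
  have hne (j : Fin m) : (Nat.card (H.map (φ j)) : ℝ≥0∞) ≠ 0 := by
    exact_mod_cast Nat.card_pos.ne'
  have hcancel : (∏ j, (Nat.card (H.map (φ j)) : ℝ≥0∞) ^ s j) *
      ∏ j, (Nat.card (H.map (φ j)) : ℝ≥0∞) ^ (-(s j)) = 1 := by
    rw [← Finset.prod_mul_distrib]
    refine Finset.prod_eq_one fun j _ => ?_
    rw [← ENNReal.rpow_add _ _ (hne j) (ENNReal.natCast_ne_top _), add_neg_cancel,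
      ENNReal.rpow_zero]
  calc HBLAloc φ s H
      ≤ (C * ∏ j, (Nat.card (H.map (φ j)) : ℝ≥0∞) ^ s j) *
          ∏ j, (Nat.card (H.map (φ j)) : ℝ≥0∞) ^ (-(s j)) :=
        mul_le_mul_left (hcard.trans htest) _
    _ = C := by rw [mul_assoc, hcancel, mul_one]

end Functional

/-- **Lemma (second splitting).** For a finite Abelian group HBL datum `𝒢` and
`s ∈ [0,1]^m`: if there is a subgroup `{0} < H < G` with `A(H,s) ≥ 1`, then
`𝔹(𝒢,s) = 𝔸(𝒢,s)`. -/
theorem HBL_second_splitting {G : Type*} [AddCommGroup G] [Fintype G]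
    {m : ℕ} (hm : 0 < m) {Gj : Fin m → Type*} [∀ j, AddCommGroup (Gj j)]
    [∀ j, Fintype (Gj j)] (φ : ∀ j, G →+ Gj j)
    (s : Fin m → ℝ) (hs : ∀ j, s j ∈ Set.Icc (0 : ℝ) 1)
    (h : ∃ H : AddSubgroup G, ⊥ < H ∧ H < ⊤ ∧ 1 ≤ HBLAloc φ s H) :
    HBLB φ s = HBLA φ s := by
  exact le_antisymm (HBLB_le_HBLA φ fun j => (hs j).1) (HBLA_le_HBLB φ fun j => (hs j).1)
end

section
/- Let 𝒢 = (φ_j : G → G_j : 1 ≤ j ≤ m) be a finite Abelian group HBL datum (i.e., G and all G_j are finite), let 𝐀 ∈ [1,∞), and let 𝒫_𝐀 = { s ∈ [0,1]^m : 𝔸(𝒢,s) ≤ 𝐀 }. Let t ∈ [0,1]^m be an extreme point of 𝒫_𝐀 such that A(G,t) ≥ 1 and A(G',t) < A(G,t) for every subgroup G' with {0} < G' < G. Then either there exists a subgroup H with {0} < H < G for which A(H,t) = 𝐀, or t_j ∈ {0,1} for all but at most one index j. -/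
open scoped ENNReal

open Filter Topology

theorem HBLAloc_eq_ofReal_exp {G : Type*} [AddCommGroup G] [Finite G] {m : ℕ}
    {Gj : Fin m → Type*} [∀ j, AddCommGroup (Gj j)] (φ : ∀ j, G →+ Gj j) (s : Fin m → ℝ)
    (H : AddSubgroup G) :
    HBLAloc φ s H = ENNReal.ofReal
      (Nat.card H * Real.exp (-∑ j, s j * Real.log (Nat.card (H.map (φ j))))) := by
  have hpos : ∀ j, (0 : ℝ) < Nat.card (H.map (φ j)) := fun j ↦ by
    have : Finite (H.map (φ j)) := Set.Finite.image (φ j) (Set.toFinite (H : Set G))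
    exact_mod_cast Nat.card_pos
  rw [HBLAloc, ENNReal.ofReal_mul (Nat.cast_nonneg _), ENNReal.ofReal_natCast,
    ← Finset.sum_neg_distrib, Real.exp_sum,
    ENNReal.ofReal_prod_of_nonneg fun j _ ↦ (Real.exp_pos _).le]
  congr 1
  refine Finset.prod_congr rfl fun j _ ↦ ?_
  rw [← ENNReal.ofReal_natCast, ENNReal.ofReal_rpow_of_pos (hpos j),
    Real.rpow_def_of_pos (hpos j)]
  congr 2
  ring

theorem continuous_HBLAloc {G : Type*} [AddCommGroup G] [Finite G] {m : ℕ}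
    {Gj : Fin m → Type*} [∀ j, AddCommGroup (Gj j)] (φ : ∀ j, G →+ Gj j)
    (H : AddSubgroup G) : Continuous fun s ↦ HBLAloc φ s H := by
  simp only [HBLAloc_eq_ofReal_exp]
  exact ENNReal.continuous_ofReal.comp (by fun_prop)

theorem HBLAloc_bot {G : Type*} [AddCommGroup G] {m : ℕ}
    {Gj : Fin m → Type*} [∀ j, AddCommGroup (Gj j)] (φ : ∀ j, G →+ Gj j) (s : Fin m → ℝ) :
    HBLAloc φ s ⊥ = 1 := by
  simp [HBLAloc]

theorem HBLAloc_le_HBLA {G : Type*} [AddCommGroup G] [Finite G] {m : ℕ}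
    {Gj : Fin m → Type*} [∀ j, AddCommGroup (Gj j)] (φ : ∀ j, G →+ Gj j) (s : Fin m → ℝ)
    (H : AddSubgroup G) : HBLAloc φ s H ≤ HBLA φ s :=
  le_iSup₂_of_le H (Set.toFinite _) le_rfl

/-- Every linear functional on `ℝ^m` has a nonzero kernel vector supported on two given
coordinates. -/
theorem exists_ne_zero_sum_mul_eq_zero {m : ℕ} (w : Fin m → ℝ) {i k : Fin m} (hik : i ≠ k) :
    ∃ v : Fin m → ℝ, v ≠ 0 ∧ (∀ j, j ≠ i → j ≠ k → v j = 0) ∧ ∑ j, v j * w j = 0 := by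
  obtain ⟨x, y, hxy, h⟩ : ∃ x y : ℝ, (x ≠ 0 ∨ y ≠ 0) ∧ x * w i + y * w k = 0 := by
    by_cases hi : w i = 0
    · exact ⟨1, 0, by simp, by simp [hi]⟩
    · exact ⟨w k, -w i, by simp [hi], by ring⟩
  refine ⟨Pi.single i x + Pi.single k y, fun h0 ↦ ?_, fun j hi hk ↦ by simp [hi, hk], ?_⟩
  · have hx := congrFun h0 i
    have hy := congrFun h0 k
    simp [hik, hik.symm] at hx hy
    exact hxy.elim (· hx) (· hy)
  · simpa [add_mul, Finset.sum_add_distrib, Pi.single_apply] using h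

/-- Perturbations along the kernel of the constraint of `⊤` stay feasible when the constraint
of every proper nontrivial subgroup is slack. -/
theorem eventually_add_smul_feasible {G : Type*} [AddCommGroup G] [Finite G] {m : ℕ}
    {Gj : Fin m → Type*} [∀ j, AddCommGroup (Gj j)] (φ : ∀ j, G →+ Gj j)
    {A : ℝ≥0∞} (hA1 : 1 ≤ A) {t v : Fin m → ℝ} (ht : ∀ j, t j ∈ Set.Icc (0 : ℝ) 1)
    (htA : HBLA φ t ≤ A) (hA : ∀ H : AddSubgroup G, ⊥ < H → H < ⊤ → HBLAloc φ t H ≠ A)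
    (hv : ∀ j, t j = 0 ∨ t j = 1 → v j = 0)
    (hvG : ∑ j, v j * Real.log (Nat.card ((⊤ : AddSubgroup G).map (φ j))) = 0) :
    ∀ᶠ ε : ℝ in 𝓝 0, (∀ j, (t + ε • v) j ∈ Set.Icc (0 : ℝ) 1) ∧ HBLA φ (t + ε • v) ≤ A := by
  have hcont : Continuous fun ε : ℝ ↦ t + ε • v := by fun_prop
  have hbox : ∀ j, ∀ᶠ ε : ℝ in 𝓝 0, (t + ε • v) j ∈ Set.Icc (0 : ℝ) 1 := fun j ↦ by
    by_cases hj : t j = 0 ∨ t j = 1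
    · simpa [hv j hj] using ht j
    · push Not at hj
      have hmem : Set.Icc (0 : ℝ) 1 ∈ 𝓝 ((t + (0 : ℝ) • v) j) := by
        simpa using Icc_mem_nhds ((ht j).1.lt_of_ne' hj.1) ((ht j).2.lt_of_ne hj.2)
      exact ((continuous_apply j).comp hcont).continuousAt.eventually_mem hmem
  have hloc : ∀ H : AddSubgroup G, ∀ᶠ ε : ℝ in 𝓝 0, HBLAloc φ (t + ε • v) H ≤ A := fun H ↦ by
    rcases eq_bot_or_bot_lt H with rfl | hbot
    · simp [HBLAloc_bot, hA1]
    rcases eq_top_or_lt_top H with rfl | htop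
    · refine Eventually.of_forall fun ε ↦ le_trans (le_of_eq ?_)
        ((HBLAloc_le_HBLA φ t ⊤).trans htA)
      simp only [HBLAloc_eq_ofReal_exp, Pi.add_apply, Pi.smul_apply, smul_eq_mul, add_mul,
        Finset.sum_add_distrib, mul_assoc, ← Finset.mul_sum, hvG, mul_zero, add_zero]
    · have hlt : HBLAloc φ (t + (0 : ℝ) • v) H < A := by
        simpa using ((HBLAloc_le_HBLA φ t H).trans htA).lt_of_ne (hA H hbot htop)
      exact (((continuous_HBLAloc φ H).comp hcont).continuousAt.eventually_lt_const hlt).mono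
        fun _ h ↦ le_of_lt h
  filter_upwards [eventually_all.2 hbox, eventually_all.2 hloc] with ε h1 h2
  exact ⟨h1, iSup₂_le fun H _ ↦ h2 H⟩

/-- **Lemma (extreme points).** Let `𝒢` be a finite Abelian group HBL datum, let
`𝐀 ∈ [1,∞)` and `𝒫_𝐀 = {s ∈ [0,1]^m : 𝔸(𝒢,s) ≤ 𝐀}`. If `t` is an extreme point of
`𝒫_𝐀` such that `A(G,t) ≥ 1` and `A(G',t) < A(G,t)` for every subgroup `{0} < G' < G`,
then either there is a subgroup `{0} < H < G` with `A(H,t) = 𝐀`, or `t_j ∈ {0,1}` for all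
but at most one index `j`. -/
theorem HBL_extreme_points {G : Type*} [AddCommGroup G] [Fintype G]
    {m : ℕ} (hm : 0 < m) {Gj : Fin m → Type*} [∀ j, AddCommGroup (Gj j)]
    [∀ j, Fintype (Gj j)] (φ : ∀ j, G →+ Gj j)
    (A : ℝ≥0∞) (hA1 : 1 ≤ A) (hAtop : A ≠ ⊤) (t : Fin m → ℝ)
    (ht : t ∈ Set.extremePoints ℝ
      {s : Fin m → ℝ | (∀ j, s j ∈ Set.Icc (0 : ℝ) 1) ∧ HBLA φ s ≤ A})
    (htG : 1 ≤ HBLAloc φ t ⊤)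
    (htG' : ∀ G' : AddSubgroup G, ⊥ < G' → G' < ⊤ → HBLAloc φ t G' < HBLAloc φ t ⊤) :
    (∃ H : AddSubgroup G, ⊥ < H ∧ H < ⊤ ∧ HBLAloc φ t H = A) ∨
      ∃ i, ∀ j, j ≠ i → t j = 0 ∨ t j = 1 := by
  by_contra! hcon
  obtain ⟨hA, hfrac⟩ := hcon
  obtain ⟨i, -, hi⟩ := hfrac ⟨0, hm⟩
  obtain ⟨k, hki, hk⟩ := hfrac i
  obtain ⟨v, hv0, hv, hvG⟩ := exists_ne_zero_sum_mul_eq_zero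
    (fun j ↦ Real.log (Nat.card ((⊤ : AddSubgroup G).map (φ j)))) hki.symm
  have hfeas := eventually_add_smul_feasible φ hA1 ht.1.1 ht.1.2 hA
    (fun j hj ↦ hv j (by rintro rfl; tauto) (by rintro rfl; tauto)) hvG
  have hneg : Tendsto (fun ε : ℝ ↦ -ε) (𝓝 0) (𝓝 0) := by
    simpa using (continuous_neg (G := ℝ)).tendsto 0
  obtain ⟨ε, ⟨hpos, hminus⟩, hε⟩ := (((hfeas.and (hneg.eventually hfeas)).filter_mono
    nhdsWithin_le_nhds).and (self_mem_nhdsWithin (a := (0 : ℝ)) (s := {0}ᶜ))).exists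
  have hseg : t ∈ openSegment ℝ (t + ε • v) (t + -ε • v) := by
    refine ⟨1 / 2, 1 / 2, by norm_num, by norm_num, by norm_num, ?_⟩
    module
  have heq : t + ε • v = t := ht.2 hpos hminus hseg
  exact (smul_ne_zero hε hv0) (by simpa using heq)
end
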